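/- Let R be an η-symmetric linear operator on ℝ^5, let α, β ∈ ℝ with β ≠ 0, and let Y, Z be vectors in ℝ^5, not both zero, satisfying R Y = α Y - β Z and R Z = β Y + α Z. Then there exists a semi-null pentad (l, m, x, y, z) and real numbers ρ3, ρ4, ρ5 such that for all u, v: η(R u, v) = α(η(l,u)η(m,v)+η(m,u)η(l,v)) + β(η(l,u)η(l,v) - η(m,u)η(m,v)) + ρ3 η(x,u)η(x,v) + ρ4 η(y,u)η(y,v) + ρ5 η(z,u)η(z,v). (Canonical form for Segre type [z z̄ 111] and its degeneracies.) -/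

import Mathlib

/-- The 5-dimensional Minkowski bilinear form of signature (-,+,+,+,+). -/
def eta (u v : Fin 5 → ℝ) : ℝ :=
  -u 0 * v 0 + u 1 * v 1 + u 2 * v 2 + u 3 * v 3 + u 4 * v 4

/-- A semi-null pentad: η(l,m) = η(x,x) = η(y,y) = η(z,z) = 1 and all other
pairwise inner products among l, m, x, y, z vanish. -/
def SemiNullPentad (l m x y z : Fin 5 → ℝ) : Prop :=
  eta l m = 1 ∧ eta x x = 1 ∧ eta y y = 1 ∧ eta z z = 1 ∧
  eta l l = 0 ∧ eta m m = 0 ∧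
  eta l x = 0 ∧ eta l y = 0 ∧ eta l z = 0 ∧
  eta m x = 0 ∧ eta m y = 0 ∧ eta m z = 0 ∧
  eta x y = 0 ∧ eta x z = 0 ∧ eta y z = 0

theorem eta_add_left' (u v w : Fin 5 → ℝ) : eta (u + v) w = eta u w + eta v w := by
  simp only [eta, Pi.add_apply]; ring

theorem eta_smul_left' (c : ℝ) (u w : Fin 5 → ℝ) : eta (c • u) w = c * eta u w := by
  simp only [eta, Pi.smul_apply, smul_eq_mul]; ring

theorem eta_comm' (u v : Fin 5 → ℝ) : eta u v = eta v u := by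
  simp only [eta]; ring

theorem eta_add_right' (u v w : Fin 5 → ℝ) : eta w (u + v) = eta w u + eta w v := by
  simp only [eta, Pi.add_apply]; ring

theorem eta_smul_right' (c : ℝ) (u w : Fin 5 → ℝ) : eta w (c • u) = c * eta w u := by
  simp only [eta, Pi.smul_apply, smul_eq_mul]; ring

theorem eta_sub_left' (u v w : Fin 5 → ℝ) : eta (u - v) w = eta u w - eta v w := by
  simp only [eta, Pi.sub_apply]; ring

theorem eta_sub_right' (u v w : Fin 5 → ℝ) : eta w (u - v) = eta w u - eta w v := by
  simp only [eta, Pi.sub_apply]; ring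

/-- A vector with vanishing time component and vanishing norm is zero. -/
theorem spatial_zero (u : Fin 5 → ℝ) (h0 : u 0 = 0) (h : eta u u ≤ 0) : u = 0 := by
  simp only [eta, h0] at h
  have h1 : u 1 = 0 := by
    nlinarith [sq_nonneg (u 1), sq_nonneg (u 2), sq_nonneg (u 3), sq_nonneg (u 4)]
  have h2 : u 2 = 0 := by
    nlinarith [sq_nonneg (u 1), sq_nonneg (u 2), sq_nonneg (u 3), sq_nonneg (u 4)]
  have h3 : u 3 = 0 := by
    nlinarith [sq_nonneg (u 1), sq_nonneg (u 2), sq_nonneg (u 3), sq_nonneg (u 4)]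
  have h4 : u 4 = 0 := by
    nlinarith [sq_nonneg (u 1), sq_nonneg (u 2), sq_nonneg (u 3), sq_nonneg (u 4)]
  funext i
  fin_cases i <;> simp [h0, h1, h2, h3, h4]

/-- The orthogonal complement of a timelike vector is positive definite. -/
theorem pos_of_orth (t u : Fin 5 → ℝ) (ht : eta t t = -2) (hu : eta t u = 0)
    (h : eta u u ≤ 0) : u = 0 := by
  apply spatial_zero u _ h
  simp only [eta] at *
  have cs : (t 1 * u 1 + t 2 * u 2 + t 3 * u 3 + t 4 * u 4) ^ 2 ≤
      (t 1 ^ 2 + t 2 ^ 2 + t 3 ^ 2 + t 4 ^ 2) * (u 1 ^ 2 + u 2 ^ 2 + u 3 ^ 2 + u 4 ^ 2) := by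
    nlinarith [sq_nonneg (t 1 * u 2 - t 2 * u 1), sq_nonneg (t 1 * u 3 - t 3 * u 1),
      sq_nonneg (t 1 * u 4 - t 4 * u 1), sq_nonneg (t 2 * u 3 - t 3 * u 2),
      sq_nonneg (t 2 * u 4 - t 4 * u 2), sq_nonneg (t 3 * u 4 - t 4 * u 3)]
  have e1 : t 1 * u 1 + t 2 * u 2 + t 3 * u 3 + t 4 * u 4 = t 0 * u 0 := by linarith
  have e2 : t 1 ^ 2 + t 2 ^ 2 + t 3 ^ 2 + t 4 ^ 2 = t 0 ^ 2 - 2 := by linarith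
  have e3 : u 1 ^ 2 + u 2 ^ 2 + u 3 ^ 2 + u 4 ^ 2 ≤ u 0 ^ 2 := by linarith
  have e4 : 0 ≤ t 0 ^ 2 - 2 := by rw [← e2]; positivity
  rw [e1, e2] at cs
  have := mul_le_mul_of_nonneg_left e3 e4
  have : u 0 ^ 2 ≤ 0 := by nlinarith
  nlinarith [sq_nonneg (u 0)]

theorem not_null (R : (Fin 5 → ℝ) →ₗ[ℝ] (Fin 5 → ℝ))
    (α β : ℝ) (hβ : β ≠ 0) (Y Z : Fin 5 → ℝ)
    (hYZ : ¬ (Y = 0 ∧ Z = 0))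
    (hY : R Y = α • Y - β • Z) (hZ : R Z = β • Y + α • Z)
    (h1 : eta Y Y = 0) (h2 : eta Y Z = 0) (h3 : eta Z Z = 0) : False := by
  have hP : Z 0 • Y - Y 0 • Z = 0 := by
    apply spatial_zero
    · simp; ring
    · simp only [eta_sub_left', eta_sub_right', eta_smul_left', eta_smul_right',
        h1, h2, h3, eta_comm' Z Y]
      simp
  have hRP := congrArg (fun w => R w 0) hP
  simp [hY, hZ] at hRP
  have : β * (Z 0 ^ 2 + Y 0 ^ 2) = 0 := by linarith
  have h := (mul_eq_zero.mp this).resolve_left hβ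
  have hz : Z 0 = 0 := by nlinarith [sq_nonneg (Z 0), sq_nonneg (Y 0)]
  have hy : Y 0 = 0 := by nlinarith [sq_nonneg (Z 0), sq_nonneg (Y 0)]
  exact hYZ ⟨spatial_zero Y hy h1.le, spatial_zero Z hz h3.le⟩

/-- Rescaling the complex eigenvector to a null pair. -/
theorem exists_null_pair (R : (Fin 5 → ℝ) →ₗ[ℝ] (Fin 5 → ℝ))
    (hR : ∀ u v : Fin 5 → ℝ, eta (R u) v = eta u (R v))
    (α β : ℝ) (hβ : β ≠ 0) (Y Z : Fin 5 → ℝ)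
    (hYZ : ¬ (Y = 0 ∧ Z = 0))
    (hY : R Y = α • Y - β • Z) (hZ : R Z = β • Y + α • Z) :
    ∃ l m : Fin 5 → ℝ, R l = α • l - β • m ∧ R m = β • l + α • m ∧
      eta l l = 0 ∧ eta m m = 0 ∧ eta l m = 1 := by
  have h := hR Y Z
  simp only [hY, hZ, eta_sub_left', eta_add_right', eta_smul_left', eta_smul_right'] at h
  have h' : eta Z Z = - eta Y Y := by
    apply mul_left_cancel₀ hβ; linarith
  have hw : (⟨eta Y Y, eta Y Z⟩ : ℂ) ≠ 0 := by
    intro hw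
    have a := congrArg Complex.re hw
    have b := congrArg Complex.im hw
    simp only [Complex.zero_re, Complex.zero_im] at a b
    exact not_null R α β hβ Y Z hYZ hY hZ a b (by rw [h', a, neg_zero])
  obtain ⟨c, hc⟩ := IsAlgClosed.exists_pow_nat_eq (Complex.I / ⟨eta Y Y, eta Y Z⟩ : ℂ)
    (n := 2) (by norm_num)
  rw [eq_div_iff hw] at hc
  have a := congrArg Complex.re hc
  have b := congrArg Complex.im hc
  simp [pow_two] at a b
  refine ⟨c.re • Y - c.im • Z, c.im • Y + c.re • Z, ?_, ?_, ?_, ?_, ?_⟩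
  · simp only [map_sub, map_smul, hY, hZ]; module
  · simp only [map_add, map_smul, hY, hZ]; module
  all_goals
    simp only [eta_sub_left', eta_sub_right', eta_add_left', eta_add_right', eta_smul_left',
      eta_smul_right', h', eta_comm' Z Y]
    linarith

/-- Spectral theorem in an abstract three-dimensional space. -/
theorem spectral3 {V : Type} [AddCommGroup V] [Module ℝ V] [FiniteDimensional ℝ V]
    (hn : Module.finrank ℝ V = 3) (c : InnerProductSpace.Core ℝ V) (T : V →ₗ[ℝ] V)
    (hT : ∀ u v, c.inner (T u) v = c.inner u (T v)) :
    ∃ (b : Fin 3 → V) (p : Fin 3 → ℝ), (∀ i, T (b i) = p i • b i) ∧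
      (∀ i j, c.inner (b i) (b j) = if i = j then 1 else 0) ∧
      ∀ v, v = ∑ i, c.inner (b i) v • b i := by
  letI : NormedAddCommGroup V := c.toNormedAddCommGroup
  letI : InnerProductSpace ℝ V := InnerProductSpace.ofCore c.toCore
  have hS : T.IsSymmetric := hT
  refine ⟨hS.eigenvectorBasis hn, hS.eigenvalues hn, ?_, ?_, ?_⟩
  · intro i; exact hS.apply_eigenvectorBasis hn i
  · exact orthonormal_iff_ite.mp (hS.eigenvectorBasis hn).orthonormal
  · intro v; exact ((hS.eigenvectorBasis hn).sum_repr' v).symm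

/-- The map `u ↦ (η(l,u), η(m,u))`. -/
def pairMap (l m : Fin 5 → ℝ) : (Fin 5 → ℝ) →ₗ[ℝ] ℝ × ℝ where
  toFun u := (eta l u, eta m u)
  map_add' u v := by simp [eta_add_right']
  map_smul' c u := by simp [eta_smul_right']

theorem mem_ker_pairMap (l m u : Fin 5 → ℝ) :
    u ∈ LinearMap.ker (pairMap l m) ↔ eta l u = 0 ∧ eta m u = 0 := by
  simp [pairMap, LinearMap.mem_ker]

theorem pairMap_finrank (l m : Fin 5 → ℝ) (hl : eta l l = 0) (hm : eta m m = 0)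
    (hlm : eta l m = 1) : Module.finrank ℝ (LinearMap.ker (pairMap l m)) = 3 := by
  have hs : Function.Surjective (pairMap l m) := by
    rintro ⟨a, b⟩
    refine ⟨a • m + b • l, ?_⟩
    simp [pairMap, eta_add_right', eta_smul_right', hl, hm, hlm, eta_comm' m l]
  have h := LinearMap.finrank_range_add_finrank_ker (pairMap l m)
  rw [LinearMap.range_eq_top.mpr hs] at h
  simp at h
  omega

theorem canonical_form_zzbar111
    (R : (Fin 5 → ℝ) →ₗ[ℝ] (Fin 5 → ℝ))
    (hR : ∀ u v : Fin 5 → ℝ, eta (R u) v = eta u (R v))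
    (α β : ℝ) (hβ : β ≠ 0) (Y Z : Fin 5 → ℝ)
    (hYZ : ¬ (Y = 0 ∧ Z = 0))
    (hY : R Y = α • Y - β • Z) (hZ : R Z = β • Y + α • Z) :
    ∃ l m x y z : Fin 5 → ℝ, SemiNullPentad l m x y z ∧
      ∃ p3 p4 p5 : ℝ, ∀ u v : Fin 5 → ℝ, eta (R u) v =
        α * (eta l u * eta m v + eta m u * eta l v) +
        β * (eta l u * eta l v - eta m u * eta m v) +
        p3 * (eta x u * eta x v) + p4 * (eta y u * eta y v) +
        p5 * (eta z u * eta z v) := by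
  obtain ⟨l, m, hl, hm, hll, hmm, hlm⟩ := exists_null_pair R hR α β hβ Y Z hYZ hY hZ
  have hml : eta m l = 1 := by rw [eta_comm', hlm]
  have hpos : ∀ u ∈ LinearMap.ker (pairMap l m), eta u u ≤ 0 → u = 0 := by
    intro u hu h
    rw [mem_ker_pairMap] at hu
    apply pos_of_orth (l - m) u _ _ h
    · simp only [eta_sub_left', eta_sub_right', hll, hmm, hlm, hml]; norm_num
    · simp only [eta_sub_left', hu.1, hu.2]; norm_num
  have hinv : ∀ u ∈ LinearMap.ker (pairMap l m), R u ∈ LinearMap.ker (pairMap l m) := by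
    intro u hu
    rw [mem_ker_pairMap] at hu ⊢
    rw [← hR, ← hR, hl, hm]
    simp [eta_sub_left', eta_add_left', eta_smul_left', hu.1, hu.2]
  let c : InnerProductSpace.Core ℝ (LinearMap.ker (pairMap l m)) :=
    { inner := fun u v => eta u.1 v.1
      conj_inner_symm := fun u v => by simp [eta_comm' u.1 v.1]
      re_inner_nonneg := fun u => by
        by_contra h
        have h' : eta u.1 u.1 < 0 := by simpa using h
        have := hpos u.1 u.2 h'.le
        rw [this] at h'
        simp [eta] at h'
      add_left := fun u v w => by simp [eta_add_left']
      smul_left := fun u v r => by simp [eta_smul_left']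
      definite := fun u h => Subtype.ext (hpos u.1 u.2 (le_of_eq h)) }
  obtain ⟨b, p, hb, ho, hsum⟩ := spectral3 (pairMap_finrank l m hll hmm hlm) c
    (R.restrict hinv) (fun u v => hR u.1 v.1)
  have hb' : ∀ i, R (b i).1 = p i • (b i).1 := fun i => congrArg Subtype.val (hb i)
  have ho' : ∀ i j, eta (b i).1 (b j).1 = if i = j then 1 else 0 := ho
  have hlb : ∀ i, eta l (b i).1 = 0 := fun i => ((mem_ker_pairMap l m _).mp (b i).2).1
  have hmb : ∀ i, eta m (b i).1 = 0 := fun i => ((mem_ker_pairMap l m _).mp (b i).2).2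
  refine ⟨l, m, b 0, b 1, b 2, ?_, p 0, p 1, p 2, ?_⟩
  · simp [SemiNullPentad, ho', hlb, hmb, hll, hmm, hlm]
  · intro u v
    have hw : u - eta m u • l - eta l u • m ∈ LinearMap.ker (pairMap l m) := by
      rw [mem_ker_pairMap]
      simp [eta_sub_right', eta_smul_right', hll, hmm, hlm, hml]
    have h1 := congrArg Subtype.val (hsum ⟨_, hw⟩)
    have h2 : ∀ i, c.inner (b i) ⟨_, hw⟩ = eta (b i).1 u := by
      intro i
      change eta (b i).1 (u - eta m u • l - eta l u • m) = _
      simp [eta_sub_right', eta_smul_right', eta_comm' _ l, eta_comm' _ m, hlb, hmb]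
    simp only [h2, Fin.sum_univ_three, Submodule.coe_add, Submodule.coe_smul] at h1
    have h3 : u = eta m u • l + eta l u • m + (eta (b 0).1 u • (b 0).1 +
        eta (b 1).1 u • (b 1).1 + eta (b 2).1 u • (b 2).1) := by
      rw [← h1]; abel
    have h4 := congrArg (fun w => eta (R w) v) h3
    simp only [map_add, map_smul, hl, hm, hb', eta_add_left', eta_sub_left', eta_smul_left'] at h4
    rw [h4]; ring
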